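/- Let (X,A₁,...,Aₙ) satisfy condition (*) with a ∈ ⋃ᵢ₌₁ⁿ Aᵢ. If π₁^top(X,a) is compact and π₁(X,a) is countable, then either the quotient space X/(A₁,...,Aₙ) is semi-locally simply connected or π₁^top(X/(A₁,...,Aₙ),*) is not Hausdorff. -/

import Mathlib

/-- The relation on `X` collapsing each member of the family `A` of subsets to a point: the
quotient `Quot (collapseRelFam A)` is the quotient space `X/(A₁,…,Aₙ)`. -/
def collapseRelFam {X : Type*} {n : ℕ} (A : Fin n → Set X) : X → X → Prop :=
  fun x y => ∃ i, x ∈ A i ∧ y ∈ A i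

/-- Condition (*) on the `(n+1)`-tuple `(X, A₁, …, Aₙ)`: either
(i) `X` is path connected and each `Aᵢ` is open with path connected closure, or
(ii) `X` is first countable, connected and locally path connected, and each `Aᵢ` is open or
closed, with pairwise disjoint path connected closures. -/
def StarCondition {X : Type*} [TopologicalSpace X] {n : ℕ} (A : Fin n → Set X) : Prop :=
  (PathConnectedSpace X ∧ ∀ i, IsOpen (A i) ∧ IsPathConnected (closure (A i))) ∨
  (FirstCountableTopology X ∧ ConnectedSpace X ∧ LocPathConnectedSpace X ∧
    (∀ i, IsOpen (A i) ∨ IsClosed (A i)) ∧ (∀ i, IsPathConnected (closure (A i))) ∧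
    ∀ i j, i ≠ j → Disjoint (closure (A i)) (closure (A j)))

/-- The topological fundamental group `π₁ᵗᵒᵖ(X,x)`: homotopy classes of loops at `x` with the
quotient topology induced from the loop space (with the compact-open topology). -/
instance pathHomotopicQuotientTopology {X : Type*} [TopologicalSpace X] (x y : X) :
    TopologicalSpace (Path.Homotopic.Quotient x y) :=
  inferInstanceAs (TopologicalSpace (Quotient (Path.Homotopic.setoid x y)))


/-- A space `Y` is semi-locally simply connected if every point `y` has an open neighborhood `U`
such that the inclusion `U → Y` induces the trivial homomorphism `π₁(U,y) → π₁(Y,y)`, i.e. every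
loop in `U` at `y` is nullhomotopic in `Y`. -/
def SemiLocallySimplyConnected (Y : Type*) [TopologicalSpace Y] : Prop :=
  ∀ y : Y, ∃ U : Set Y, IsOpen U ∧ ∃ hy : y ∈ U,
    ∀ γ : Path (⟨y, hy⟩ : U) (⟨y, hy⟩ : U),
      (γ.map continuous_subtype_val).Homotopic (Path.refl y)

open Set Filter Topology unitInterval

section Homotopy

variable {Y : Type*} [TopologicalSpace Y]

/-- Two paths with the same endpoints, all of whose points are specializations of one point,
are homotopic. -/
theorem Path.Homotopic.of_specializes {c y₀ y₁ : Y} (h k : Path y₀ y₁)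
    (hh : ∀ t, c ⤳ h t) (hk : ∀ t, c ⤳ k t) : h.Homotopic k := by
  classical
  let H : I × I → Y := fun z =>
    if z.1 = 0 then h z.2 else if z.1 = 1 then k z.2 else
      if z.2 = 0 then y₀ else if z.2 = 1 then y₁ else c
  have hc : ∀ z, c ⤳ H z := by
    intro z
    have h0 := hh 0
    have h1 := hh 1
    rw [Path.source] at h0
    rw [Path.target] at h1
    simp only [H]
    split_ifs
    exacts [hh _, hk _, h0, h1, specializes_rfl]
  have hH : Continuous H := by
    refine continuous_iff_isClosed.2 fun F hF => ?_
    by_cases hcF : c ∈ F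
    · have : H ⁻¹' F = univ := eq_univ_of_forall fun z => (hc z).mem_closed hF hcF
      simp [this]
    · have : H ⁻¹' F = (({0} : Set I) ×ˢ (h ⁻¹' F)) ∪ (({1} : Set I) ×ˢ (k ⁻¹' F)) ∪
          ((univ : Set I) ×ˢ ({0} ∩ h ⁻¹' F)) ∪ ((univ : Set I) ×ˢ ({1} ∩ h ⁻¹' F)) := by
        ext ⟨s, t⟩
        simp only [mem_union, mem_prod, mem_preimage, mem_singleton_iff, mem_univ, true_and,
          mem_inter_iff, H]
        by_cases ht0 : t = 0
        · subst ht0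
          simp only [Path.source, zero_ne_one, if_true, true_and, false_and, or_false]
          split_ifs <;> tauto
        by_cases ht1 : t = 1
        · subst ht1
          simp only [Path.target, one_ne_zero, if_false, if_true, true_and, false_and, or_false]
          split_ifs <;> tauto
        simp only [ht0, ht1, if_false, false_and, or_false]
        split_ifs with hs0 hs1
        · simp [hs0]
        · simp [hs1]
        · simp [hs0, hs1, hcF]
      rw [this]
      have h1 := hF.preimage h.continuous
      have h2 := hF.preimage k.continuous
      exact (((isClosed_singleton.prod h1).union (isClosed_singleton.prod h2)).union
        (isClosed_univ.prod (isClosed_singleton.inter h1))).union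
        (isClosed_univ.prod (isClosed_singleton.inter h1))
  refine ⟨{ toFun := H, continuous_toFun := hH, map_zero_left := ?_, map_one_left := ?_,
            prop' := ?_ }⟩
  · intro t; simp [H]
  · intro t; simp [H]
  · intro s t ht
    rcases ht with rfl | rfl
    · simp only [ContinuousMap.coe_mk, H, Path.source, if_true, ite_self]
      exact h.source.symm
    · simp only [ContinuousMap.coe_mk, H, Path.target, one_ne_zero, if_false, if_true, ite_self]
      exact h.target.symm

/-- Every neighbourhood of a constant loop contains all loops in some neighbourhood of the
base point. -/
theorem Path.exists_isOpen_forall_mem_of_mem_nhds_refl {y : Y} {S : Set (Path y y)}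
    (hS : S ∈ 𝓝 (Path.refl y)) :
    ∃ U : Set Y, IsOpen U ∧ y ∈ U ∧ ∀ γ : Path y y, (∀ t, γ t ∈ U) → γ ∈ S := by
  rw [nhds_induced, mem_comap] at hS
  obtain ⟨T, hT, hTS⟩ := hS
  obtain ⟨B, hB, hKU, hBT⟩ := ContinuousMap.mem_nhds_iff.1 hT
  refine ⟨⋂ P ∈ {P ∈ B | P.1.Nonempty}, P.2, ?_, ?_, ?_⟩
  · exact (hB.subset (sep_subset _ _)).isOpen_biInter fun P hP => (hKU P.1 P.2 hP.1).2.1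
  · simp only [mem_iInter]
    rintro P ⟨hP, t, ht⟩
    exact (hKU P.1 P.2 hP).2.2 ht
  · intro γ hγ
    refine hTS (hBT fun K U hP t ht => ?_)
    have := hγ t
    simp only [mem_iInter] at this
    exact this (K, U) ⟨hP, t, ht⟩

/-- A basic neighbourhood of a path, seen at a small dyadic scale. -/
theorem Path.exists_dyadic_of_mem_nhds {y₀ y₁ : Y} {γ : Path y₀ y₁} {S : Set (Path y₀ y₁)}
    (hS : S ∈ 𝓝 γ) :
    ∃ (n : ℕ) (W : I → Set Y),
      (∀ s : I, ∃ V, IsOpen V ∧ ∀ t : I, |(t : ℝ) - s| ≤ (1 / 2) ^ n → γ t ∈ V ∧ V ⊆ W t) ∧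
      ∀ δ : Path y₀ y₁, (∀ t, δ t ∈ W t) → δ ∈ S := by
  rw [nhds_induced, mem_comap] at hS
  obtain ⟨T, hT, hTS⟩ := hS
  obtain ⟨B, hB, hKU, hBT⟩ := ContinuousMap.mem_nhds_iff.1 hT
  have key : ∀ᶠ r : ℝ in 𝓝[>] 0, ∀ P ∈ B, Metric.thickening r P.1 ⊆ γ ⁻¹' P.2 := by
    refine (eventually_all_finite hB).2 fun P hP => ?_
    obtain ⟨hK, hU, hm⟩ := hKU P.1 P.2 hP
    obtain ⟨r, hr, hsub⟩ := hK.exists_thickening_subset_open (hU.preimage γ.continuous) hm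
    filter_upwards [Ioo_mem_nhdsGT hr] with r' hr'
    exact (Metric.thickening_mono hr'.2.le _).trans hsub
  obtain ⟨r, hr, hr0⟩ := (key.and self_mem_nhdsWithin).exists
  replace hr0 : 0 < r := hr0
  obtain ⟨n, hn⟩ := exists_pow_lt_of_lt_one (half_pos hr0) (by norm_num : (1 / 2 : ℝ) < 1)
  refine ⟨n, fun t => {y | ∀ P ∈ B, t ∈ P.1 → y ∈ P.2}, fun s => ?_, fun δ hδ => ?_⟩
  · refine ⟨⋂ P ∈ {P ∈ B | ∃ t ∈ P.1, |(t : ℝ) - s| ≤ (1 / 2) ^ n}, P.2, ?_, ?_⟩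
    · exact (hB.subset (sep_subset _ _)).isOpen_biInter fun P hP => (hKU P.1 P.2 hP.1).2.1
    · intro t ht
      constructor
      · simp only [mem_iInter]
        rintro P ⟨hP, u, huP, hu⟩
        refine hr P hP (Metric.mem_thickening_iff.2 ⟨u, huP, ?_⟩)
        rw [Subtype.dist_eq, Real.dist_eq]
        rw [abs_le] at ht hu
        rw [abs_lt]
        constructor <;> linarith [ht.1, ht.2, hu.1, hu.2]
      · intro y hy P hP htP
        simp only [mem_iInter] at hy
        exact hy P ⟨hP, t, htP, ht⟩
  · exact hTS (hBT fun K U hP t ht => hδ t (K, U) hP ht)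

end Homotopy

section LiftRel

variable {X Y : Type*} [TopologicalSpace X] [TopologicalSpace Y]

/-- Two points `x`, `x'` are `LiftRel p V` related when some path joining them in `X` has an image
in `Y` that can be deformed into `V`. -/
def LiftRel (p : C(X, Y)) (V : Set Y) (x x' : X) : Prop :=
  ∃ (f : Path x x') (δ : Path (p x) (p x')),
    (f.map p.continuous).Homotopic δ ∧ ∀ t, δ t ∈ V

variable {p : C(X, Y)} {V : Set Y} {x y z : X}

theorem LiftRel.of_joinedIn (h : JoinedIn (p ⁻¹' V) x y) : LiftRel p V x y :=
  ⟨h.somePath, h.somePath.map p.continuous, .refl _, h.somePath_mem⟩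

theorem LiftRel.refl (hx : p x ∈ V) : LiftRel p V x x :=
  .of_joinedIn (JoinedIn.refl hx)

theorem LiftRel.symm (h : LiftRel p V x y) : LiftRel p V y x := by
  obtain ⟨f, δ, h, hδ⟩ := h
  exact ⟨f.symm, δ.symm, h.symm₂, fun t => hδ _⟩

theorem LiftRel.trans (h : LiftRel p V x y) (h' : LiftRel p V y z) : LiftRel p V x z := by
  obtain ⟨f, δ, h, hδ⟩ := h
  obtain ⟨f', δ', h', hδ'⟩ := h'
  refine ⟨f.trans f', δ.trans δ', ?_, fun t => ?_⟩
  · rw [Path.map_trans]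
    exact h.hcomp h'
  · have : (δ.trans δ') t ∈ range (δ.trans δ') := mem_range_self t
    rw [Path.trans_range] at this
    rcases this with ⟨s, hs⟩ | ⟨s, hs⟩
    · exact hs ▸ hδ s
    · exact hs ▸ hδ' s

theorem LiftRel.mem_right (h : LiftRel p V x y) : p y ∈ V := by
  obtain ⟨f, δ, h, hδ⟩ := h
  simpa using hδ 1

theorem LiftRel.of_mem_closure {B : Set X} (hB : IsPathConnected (closure B))
    (hp : ∀ b ∈ B, p b = p x) (hx : x ∈ B) (hy : y ∈ closure B) (hxV : p x ∈ V) (hyV : p y ∈ V) :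
    LiftRel p V x y := by
  have hspec : ∀ w ∈ closure B, p x ⤳ p w := by
    intro w hw
    rw [specializes_iff_mem_closure]
    refine closure_mono ?_ (image_closure_subset_closure_image p.continuous (mem_image_of_mem p hw))
    rintro _ ⟨b, hb, rfl⟩
    exact hp b hb
  have hf := hB.joinedIn x (subset_closure hx) y hy
  have hδ : JoinedIn (V ∩ {w | p x ⤳ w}) (p x) (p y) :=
    (hspec y hy).joinedIn ⟨hxV, specializes_rfl⟩ ⟨hyV, hspec y hy⟩
  exact ⟨hf.somePath, hδ.somePath,
    .of_specializes _ _ (fun t => hspec _ (hf.somePath_mem t)) fun t => (hδ.somePath_mem t).2,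
    fun t => (hδ.somePath_mem t).1⟩

/-- If paths lift up to deformation inside every open set, then they lift up to a deformation
which is controlled at a dyadic scale. -/
theorem exists_path_homotopic_of_dyadic (hp : Function.Surjective p)
    (hlift : ∀ V : Set Y, IsOpen V → ∀ (x x' : X) (γ : Path (p x) (p x')), (∀ t, γ t ∈ V) →
      LiftRel p V x x') (n : ℕ) :
    ∀ (x x' : X) (γ : Path (p x) (p x')) (W : I → Set Y),
      (∀ s : I, ∃ V, IsOpen V ∧ ∀ t : I, |(t : ℝ) - s| ≤ (1 / 2) ^ n → γ t ∈ V ∧ V ⊆ W t) →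
      ∃ (f : Path x x') (δ : Path (p x) (p x')),
        (f.map p.continuous).Homotopic δ ∧ ∀ t, δ t ∈ W t := by
  induction n with
  | zero =>
    intro x x' γ W h
    obtain ⟨V, hV, hVW⟩ := h 0
    have hle : ∀ t : I, |(t : ℝ) - (0 : I)| ≤ (1 / 2) ^ 0 := fun t => by
      simpa [abs_of_nonneg t.2.1] using t.2.2
    obtain ⟨f, δ, h, hδ⟩ := hlift V hV x x' γ fun t => (hVW t (hle t)).1
    exact ⟨f, δ, h, fun t => (hVW t (hle t)).2 (hδ t)⟩
  | succ n ih =>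
    intro x x' γ W h
    let h₁ : I → I := fun t => ⟨t / 2, by constructor <;> linarith [t.2.1, t.2.2]⟩
    let h₂ : I → I := fun t => ⟨(1 + t) / 2, by constructor <;> linarith [t.2.1, t.2.2]⟩
    have c₁ : Continuous h₁ := by fun_prop
    have c₂ : Continuous h₂ := by fun_prop
    obtain ⟨m, hm⟩ := hp (γ (h₁ 1))
    let γ₁ : Path (p x) (p m) :=
      { toFun := fun t => γ (h₁ t)
        continuous_toFun := γ.continuous.comp c₁
        source' := by
          rw [show h₁ 0 = 0 from Subtype.ext (by simp [h₁])]; exact γ.source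
        target' := hm.symm }
    let γ₂ : Path (p m) (p x') :=
      { toFun := fun t => γ (h₂ t)
        continuous_toFun := γ.continuous.comp c₂
        source' := by
          rw [hm, show h₂ 0 = h₁ 1 from Subtype.ext (by simp [h₁, h₂])]
        target' := by
          rw [show h₂ 1 = 1 from Subtype.ext (by norm_num [h₂])]; exact γ.target }
    obtain ⟨f₁, δ₁, hh₁, hδ₁⟩ := ih x m γ₁ (fun t => W (h₁ t)) fun s => by
      obtain ⟨V, hV, hVW⟩ := h (h₁ s)
      refine ⟨V, hV, fun t ht => hVW (h₁ t) ?_⟩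
      have : ((h₁ t : ℝ) - h₁ s) = ((t : ℝ) - s) * (1 / 2) := by simp only [h₁]; ring
      rw [this, abs_mul, pow_succ, abs_of_pos (by norm_num : (0 : ℝ) < 1 / 2)]
      gcongr
    obtain ⟨f₂, δ₂, hh₂, hδ₂⟩ := ih m x' γ₂ (fun t => W (h₂ t)) fun s => by
      obtain ⟨V, hV, hVW⟩ := h (h₂ s)
      refine ⟨V, hV, fun t ht => hVW (h₂ t) ?_⟩
      have : ((h₂ t : ℝ) - h₂ s) = ((t : ℝ) - s) * (1 / 2) := by simp only [h₂]; ring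
      rw [this, abs_mul, pow_succ, abs_of_pos (by norm_num : (0 : ℝ) < 1 / 2)]
      gcongr
    refine ⟨f₁.trans f₂, δ₁.trans δ₂, ?_, fun t => ?_⟩
    · rw [Path.map_trans]
      exact hh₁.hcomp hh₂
    · rw [Path.trans_apply]
      split_ifs with ht
      · convert hδ₁ _ using 2
        exact Subtype.ext (by simp [h₁])
      · convert hδ₂ _ using 2
        exact Subtype.ext (by simp [h₂])

end LiftRel

section Collapse

variable {X : Type*} [TopologicalSpace X] {n : ℕ} {A : Fin n → Set X}

/-- The quotient map `X → X/(A₁,…,Aₙ)`. -/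
def collapseMap (A : Fin n → Set X) : C(X, Quot (collapseRelFam A)) :=
  ⟨Quot.mk _, continuous_quot_mk⟩

theorem collapseMap_eq_of_mem {i : Fin n} {x y : X} (hx : x ∈ A i) (hy : y ∈ A i) :
    collapseMap A x = collapseMap A y :=
  Quot.sound ⟨i, hx, hy⟩

theorem collapseMap_surjective : Function.Surjective (collapseMap A) :=
  Quot.mk_surjective

theorem isQuotientMap_collapseMap : IsQuotientMap (collapseMap A) :=
  isQuotientMap_quot_mk

theorem eq_or_mem_of_collapseMap_eq {x y : X} (h : collapseMap A x = collapseMap A y) :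
    x = y ∨ (∃ i, x ∈ A i) ∧ ∃ i, y ∈ A i := by
  have h' : Relation.EqvGen (collapseRelFam A) x y := Quot.eqvGen_exact h
  clear h
  induction h' with
  | rel x y h => obtain ⟨i, hx, hy⟩ := h; exact .inr ⟨⟨i, hx⟩, i, hy⟩
  | refl x => exact .inl rfl
  | symm x y _ ih =>
    rcases ih with rfl | ⟨h, h'⟩
    exacts [.inl rfl, .inr ⟨h', h⟩]
  | trans x y z _ _ ih ih' =>
    rcases ih with rfl | ⟨h, h'⟩
    · exact ih'
    · rcases ih' with rfl | ⟨_, h''⟩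
      exacts [.inr ⟨h, h'⟩, .inr ⟨h, h''⟩]

theorem LiftRel.of_mem_closure_collapse {V : Set (Quot (collapseRelFam A))} {i : Fin n}
    (hA : IsPathConnected (closure (A i))) {x y : X}
    (hx : x ∈ A i) (hy : y ∈ closure (A i)) (hxV : collapseMap A x ∈ V)
    (hyV : collapseMap A y ∈ V) : LiftRel (collapseMap A) V x y :=
  .of_mem_closure hA (fun _ hb => collapseMap_eq_of_mem hb hx) hx hy hxV hyV

theorem LiftRel.of_collapseMap_eq {V : Set (Quot (collapseRelFam A))}
    (hA : ∀ i, IsPathConnected (closure (A i))) {x y : X}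
    (h : collapseMap A x = collapseMap A y) (hx : collapseMap A x ∈ V) :
    LiftRel (collapseMap A) V x y := by
  have h' : Relation.EqvGen (collapseRelFam A) x y := Quot.eqvGen_exact h
  clear h
  induction h' with
  | rel x y h =>
    obtain ⟨i, hxi, hyi⟩ := h
    exact .of_mem_closure_collapse (hA i) hxi (subset_closure hyi) hx
      (collapseMap_eq_of_mem hxi hyi ▸ hx)
  | refl x => exact .refl hx
  | symm x y h ih =>
    have : collapseMap A x = collapseMap A y := Quot.eqvGen_sound h
    exact (ih (this ▸ hx)).symm
  | trans x y z h _ ih ih' =>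
    have : collapseMap A x = collapseMap A y := Quot.eqvGen_sound h
    exact (ih hx).trans (ih' (this ▸ hx))

theorem LiftRel.of_path_of_locallyPathConnectedSpace [LocallyPathConnectedSpace X]
    (hA : ∀ i, IsPathConnected (closure (A i))) {V : Set (Quot (collapseRelFam A))}
    (hV : IsOpen V) (x x' : X) (γ : Path (collapseMap A x) (collapseMap A x'))
    (hγ : ∀ t, γ t ∈ V) : LiftRel (collapseMap A) V x x' := by
  have hopen : ∀ P : X → Prop, (∀ y z, collapseMap A y ∈ V → P y → LiftRel (collapseMap A) V y z → P z) →
      IsOpen (collapseMap A '' {y | collapseMap A y ∈ V ∧ P y}) := by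
    intro P hP
    rw [← isQuotientMap_collapseMap.isOpen_preimage, isOpen_iff_mem_nhds]
    rintro z ⟨y, ⟨hyV, hy⟩, hyz⟩
    have hzV : collapseMap A z ∈ V := hyz ▸ hyV
    have hPz : P z := hP y z hyV hy (.of_collapseMap_eq hA hyz hyV)
    filter_upwards [pathComponentIn_mem_nhds ((hV.preimage (collapseMap A).continuous).mem_nhds hzV)] with w hw
    have := LiftRel.of_joinedIn (p := collapseMap A) (V := V) hw
    exact ⟨w, ⟨this.mem_right, hP z w hzV hPz this⟩, rfl⟩
  have h1 := hopen (fun y => LiftRel (collapseMap A) V x y) fun y z _ h h' => h.trans h'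
  have h2 := hopen (fun y => ¬ LiftRel (collapseMap A) V x y) fun y z _ h h' h'' => h (h''.trans h'.symm)
  have hxV : collapseMap A x ∈ V := by simpa using hγ 0
  have hcov : (γ ⁻¹' (collapseMap A '' {y | collapseMap A y ∈ V ∧ LiftRel (collapseMap A) V x y}))ᶜ =
      γ ⁻¹' (collapseMap A '' {y | collapseMap A y ∈ V ∧ ¬ LiftRel (collapseMap A) V x y}) := by
    ext t
    simp only [mem_compl_iff, mem_preimage]
    constructor
    · intro h
      obtain ⟨y, hy⟩ := collapseMap_surjective (γ t)
      have hyV : collapseMap A y ∈ V := hy ▸ hγ t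
      exact ⟨y, ⟨hyV, fun hxy => h ⟨y, ⟨hyV, hxy⟩, hy⟩⟩, hy⟩
    · rintro ⟨y, ⟨hyV, hy⟩, hyt⟩ ⟨z, ⟨hzV, hz⟩, hzt⟩
      exact hy (hz.trans (.of_collapseMap_eq hA (hzt.trans hyt.symm) hzV))
  have hclopen : IsClopen (γ ⁻¹' (collapseMap A '' {y | collapseMap A y ∈ V ∧ LiftRel (collapseMap A) V x y})) :=
    ⟨⟨hcov ▸ h2.preimage γ.continuous⟩, h1.preimage γ.continuous⟩
  have huniv := hclopen.eq_univ ⟨0, x, ⟨hxV, .refl hxV⟩, γ.source.symm⟩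
  obtain ⟨y, ⟨hyV, hy⟩, hyx⟩ : (1 : I) ∈ γ ⁻¹' (collapseMap A '' {y | collapseMap A y ∈ V ∧ LiftRel (collapseMap A) V x y}) :=
    huniv ▸ mem_univ _
  exact hy.trans (.of_collapseMap_eq hA (hyx.trans γ.target) hyV)

theorem isOpen_singleton_collapseMap (hO : ∀ i, IsOpen (A i)) {j : Fin n} {b : X} (hb : b ∈ A j) :
    IsOpen {collapseMap A b} := by
  rw [← isQuotientMap_collapseMap.isOpen_preimage, isOpen_iff_mem_nhds]
  intro y hy
  have : ∃ i, y ∈ A i := by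
    rcases eq_or_mem_of_collapseMap_eq (show collapseMap A y = collapseMap A b from hy) with
      rfl | ⟨h, -⟩
    exacts [⟨j, hb⟩, h]
  obtain ⟨i, hi⟩ := this
  filter_upwards [(hO i).mem_nhds hi] with z hz
  exact (collapseMap_eq_of_mem hz hi).trans hy

theorem exists_mem_closure_of_specializes (hO : ∀ i, IsOpen (A i)) {j : Fin n} {b x : X}
    (hb : b ∈ A j) (h : collapseMap A b ⤳ collapseMap A x) :
    ∃ i, x ∈ closure (A i) ∧ ∃ b' ∈ A i, collapseMap A b' = collapseMap A b := by
  by_contra! hcon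
  set p := collapseMap A with hp
  let J : Set (Fin n) := {i | ∃ b' ∈ A i, p b' = p b}
  let W : Set X := (⋃ i ∈ Jᶜ, A i) ∪ ⋂ i ∈ J, (closure (A i))ᶜ
  have hW : IsOpen W := (isOpen_biUnion fun i _ => hO i).union
    ((toFinite J).isOpen_biInter fun i _ => isClosed_closure.isOpen_compl)
  have hbW : ∀ w ∈ W, p w ≠ p b := by
    rintro w (hw | hw) hwb
    · simp only [mem_iUnion] at hw
      obtain ⟨i, hi, hwi⟩ := hw
      exact hi ⟨w, hwi, hwb⟩
    · simp only [mem_iInter] at hw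
      obtain ⟨k, hk⟩ : ∃ k, w ∈ A k := by
        rcases eq_or_mem_of_collapseMap_eq hwb with rfl | ⟨h, -⟩
        exacts [⟨j, hb⟩, h]
      exact hw k ⟨w, hk, hwb⟩ (subset_closure hk)
  have hpW : IsOpen (p '' W) := by
    rw [← isQuotientMap_collapseMap.isOpen_preimage]
    convert hW using 1
    refine Subset.antisymm ?_ (subset_preimage_image p W)
    rintro y ⟨w, hw, hwy⟩
    rcases eq_or_mem_of_collapseMap_eq hwy with rfl | ⟨-, k, hk⟩
    · exact hw
    · refine .inl (mem_biUnion (x := k) ?_ hk)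
      rintro ⟨b', hb', hbb'⟩
      exact hbW w hw (hwy.trans ((collapseMap_eq_of_mem hk hb').trans hbb'))
  have hxW : x ∈ W := by
    refine .inr ?_
    simp only [mem_iInter]
    rintro i ⟨b', hb', hbb'⟩ hxi
    exact hcon i hxi b' hb' hbb'
  obtain ⟨w, hw, hwb⟩ := specializes_iff_forall_open.1 h _ hpW (mem_image_of_mem p hxW)
  exact hbW w hw hwb

theorem LiftRel.of_specializes (hO : ∀ i, IsOpen (A i)) (hA : ∀ i, IsPathConnected (closure (A i)))
    {V : Set (Quot (collapseRelFam A))} {j : Fin n} {b x : X} (hb : b ∈ A j)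
    (h : collapseMap A b ⤳ collapseMap A x) (hbV : collapseMap A b ∈ V)
    (hxV : collapseMap A x ∈ V) : LiftRel (collapseMap A) V b x := by
  obtain ⟨i, hxi, b', hb', hbb'⟩ := exists_mem_closure_of_specializes hO hb h
  exact (LiftRel.of_collapseMap_eq hA hbb'.symm hbV).trans
    (.of_mem_closure_collapse (hA i) hb' hxi (hbb' ▸ hbV) hxV)

theorem continuousOn_lift_of_notMem (hO : ∀ i, IsOpen (A i)) {T : Type*} [TopologicalSpace T]
    {g : T → Quot (collapseRelFam A)} (hg : Continuous g) {r : T → X}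
    (hr : ∀ t, collapseMap A (r t) = g t) {s : Set T} (hs : ∀ t ∈ s, ∀ i, r t ∉ A i) :
    ContinuousOn r s := by
  have hC : IsClosed {x : X | ∀ i, x ∉ A i} := by
    simp only [ofPred_forall]
    exact isClosed_iInter fun i => (hO i).isClosed_compl
  refine continuousOn_iff_isClosed.2 fun K hK =>
    ⟨g ⁻¹' (collapseMap A '' (K ∩ {x | ∀ i, x ∉ A i})), ?_, ?_⟩
  · refine IsClosed.preimage hg ?_
    rw [← isQuotientMap_collapseMap.isClosed_preimage]
    convert hK.inter hC using 1
    refine Subset.antisymm ?_ (subset_preimage_image _ _)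
    rintro y ⟨w, hw, hwy⟩
    rcases eq_or_mem_of_collapseMap_eq hwy with rfl | ⟨⟨i, hi⟩, -⟩
    exacts [hw, absurd hi (hw.2 i)]
  · ext t
    constructor
    · rintro ⟨ht, hts⟩
      exact ⟨⟨r t, ⟨ht, hs t hts⟩, hr t⟩, hts⟩
    · rintro ⟨⟨w, hw, hwt⟩, hts⟩
      refine ⟨?_, hts⟩
      rcases eq_or_mem_of_collapseMap_eq (hwt.trans (hr t).symm) with rfl | ⟨⟨i, hi⟩, -⟩
      exacts [hw.1, absurd hi (hw.2 i)]

theorem LiftRel.of_continuous_of_isOpen (hO : ∀ i, IsOpen (A i))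
    (hA : ∀ i, IsPathConnected (closure (A i))) {V : Set (Quot (collapseRelFam A))}
    {g : ℝ → Quot (collapseRelFam A)} (hg : Continuous g) (hgV : ∀ t, g t ∈ V) {r : ℝ → X}
    (hr : ∀ t, collapseMap A (r t) = g t) (S : Finset (Fin n)) :
    ∀ s t, s ≤ t → (∀ i ∉ S, ∀ u ∈ Icc s t, g u ∉ collapseMap A '' A i) →
      LiftRel (collapseMap A) V (r s) (r t) := by
  induction S using Finset.induction_on with
  | empty =>
    intro s t hst h
    have hc : ContinuousOn r (Icc s t) := continuousOn_lift_of_notMem hO hg hr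
      fun u hu i hi => h i (Finset.notMem_empty i) u hu ⟨r u, hi, hr u⟩
    have hpc : IsPathConnected (r '' Icc s t) :=
      ((convex_Icc s t).isPathConnected (nonempty_Icc.2 hst)).image' hc
    refine .of_joinedIn ((hpc.joinedIn _ (mem_image_of_mem r (left_mem_Icc.2 hst)) _
      (mem_image_of_mem r (right_mem_Icc.2 hst))).mono ?_)
    rintro _ ⟨u, -, rfl⟩
    exact mem_preimage.2 ((hr u).symm ▸ hgV u)
  | insert j S _ ih =>
    intro s t hst h
    by_cases hne : ∃ u ∈ Icc s t, g u ∈ collapseMap A '' A j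
    swap
    · push Not at hne
      refine ih s t hst fun i hi u hu => ?_
      by_cases hij : i = j
      · exact hij ▸ hne u hu
      · exact h i (by simp [hij, hi]) u hu
    obtain ⟨u₀, hu₀, b, hb, hbu⟩ := hne
    have himg : ∀ u, g u ∈ collapseMap A '' A j ↔ g u = collapseMap A b := fun u =>
      ⟨fun ⟨b', hb', h'⟩ => h'.symm.trans (collapseMap_eq_of_mem hb' hb),
        fun h' => ⟨b, hb, h'.symm⟩⟩
    have hOj : IsOpen {u | g u = collapseMap A b} :=
      (isOpen_singleton_collapseMap hO hb).preimage hg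
    let D : Set ℝ := {u | u ∈ Icc s t ∧ g u = collapseMap A b}
    have hD : D.Nonempty := ⟨u₀, hu₀, hbu.symm⟩
    have hDb : BddBelow D := ⟨s, fun u hu => hu.1.1⟩
    have hDa : BddAbove D := ⟨t, fun u hu => hu.1.2⟩
    have hbV : collapseMap A b ∈ V := hbu ▸ hgV u₀
    have hcl : ∀ u ∈ closure D, LiftRel (collapseMap A) V b (r u) := by
      intro u hu
      refine .of_specializes hO hA hb ?_ hbV ((hr u).symm ▸ hgV u)
      rw [hr, specializes_iff_mem_closure]
      refine closure_mono ?_ (image_closure_subset_closure_image hg (mem_image_of_mem g hu))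
      rintro _ ⟨w, hw, rfl⟩
      exact hw.2
    have hu := csInf_mem_closure hD hDb
    have hv := csSup_mem_closure hD hDa
    have hDI : closure D ⊆ Icc s t := closure_minimal (fun u hu => hu.1) isClosed_Icc
    have hleft : LiftRel (collapseMap A) V (r s) (r (sInf D)) := by
      rcases (hDI hu).1.eq_or_lt with heq | hlt
      · rw [← heq]
        exact .refl ((hr s).symm ▸ hgV s)
      · refine ih _ _ hlt.le fun i hi w hw => ?_
        by_cases hij : i = j
        · subst hij
          rw [himg]
          intro hwb
          have hw' : sInf D ≤ w := csInf_le hDb ⟨⟨hw.1, hw.2.trans (hDI hu).2⟩, hwb⟩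
          have hwe : w = sInf D := le_antisymm hw.2 hw'
          have hev : ∀ᶠ v in 𝓝[<] (sInf D), v ∈ Ioo s (sInf D) ∧ g v = collapseMap A b :=
            Filter.Eventually.and (Ioo_mem_nhdsLT hlt)
              (nhdsWithin_le_nhds (hOj.mem_nhds (hwe ▸ hwb)))
          obtain ⟨v, hv1, hv2⟩ := hev.exists
          exact hv1.2.not_ge (csInf_le hDb ⟨⟨hv1.1.le, hv1.2.le.trans (hDI hu).2⟩, hv2⟩)
        · exact h i (by simp [hij, hi]) w ⟨hw.1, hw.2.trans (hDI hu).2⟩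
    have hright : LiftRel (collapseMap A) V (r (sSup D)) (r t) := by
      rcases (hDI hv).2.eq_or_lt with heq | hlt
      · rw [heq]
        exact .refl ((hr t).symm ▸ hgV t)
      · refine ih _ _ hlt.le fun i hi w hw => ?_
        by_cases hij : i = j
        · subst hij
          rw [himg]
          intro hwb
          have hw' : w ≤ sSup D := le_csSup hDa ⟨⟨(hDI hv).1.trans hw.1, hw.2⟩, hwb⟩
          have hwe : w = sSup D := le_antisymm hw' hw.1
          have hev : ∀ᶠ v in 𝓝[>] (sSup D), v ∈ Ioo (sSup D) t ∧ g v = collapseMap A b :=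
            Filter.Eventually.and (Ioo_mem_nhdsGT hlt)
              (nhdsWithin_le_nhds (hOj.mem_nhds (hwe ▸ hwb)))
          obtain ⟨v, hv1, hv2⟩ := hev.exists
          exact hv1.1.not_ge (le_csSup hDa ⟨⟨(hDI hv).1.trans hv1.1.le, hv1.2.le⟩, hv2⟩)
        · exact h i (by simp [hij, hi]) w ⟨(hDI hv).1.trans hw.1, hw.2⟩
    exact hleft.trans ((hcl _ hu).symm.trans ((hcl _ hv).trans hright))

theorem LiftRel.of_path_of_isOpen (hO : ∀ i, IsOpen (A i))
    (hA : ∀ i, IsPathConnected (closure (A i))) {V : Set (Quot (collapseRelFam A))}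
    (x x' : X) (γ : Path (collapseMap A x) (collapseMap A x'))
    (hγ : ∀ t, γ t ∈ V) : LiftRel (collapseMap A) V x x' := by
  have hV : ∀ t, γ.extend t ∈ V := fun t => hγ _
  choose r hr using fun t : ℝ => collapseMap_surjective (A := A) (γ.extend t)
  have h := LiftRel.of_continuous_of_isOpen hO hA γ.continuous_extend hV hr Finset.univ 0 1
    zero_le_one fun i hi => absurd (Finset.mem_univ i) hi
  refine (LiftRel.of_collapseMap_eq hA ?_ ?_).trans (h.trans (.of_collapseMap_eq hA ?_ ?_))
  · rw [hr, Path.extend_zero]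
  · simpa using hγ 0
  · rw [hr, Path.extend_one]
  · rw [hr]; exact hV 1

theorem StarCondition.liftRel (hstar : StarCondition A) {V : Set (Quot (collapseRelFam A))}
    (hV : IsOpen V) (x x' : X) (γ : Path (collapseMap A x) (collapseMap A x'))
    (hγ : ∀ t, γ t ∈ V) : LiftRel (collapseMap A) V x x' := by
  rcases hstar with ⟨-, h⟩ | ⟨-, -, hX, -, hA, -⟩
  · exact .of_path_of_isOpen (fun i => (h i).1) (fun i => (h i).2) x x' γ hγ
  · have : LocallyPathConnectedSpace X := hX
    exact .of_path_of_locallyPathConnectedSpace hA hV x x' γ hγ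

theorem StarCondition.pathConnectedSpace (hstar : StarCondition A) : PathConnectedSpace X := by
  rcases hstar with ⟨h, -⟩ | ⟨-, _, hX, -⟩
  · exact h
  · have : LocallyPathConnectedSpace X := hX
    exact pathConnectedSpace_iff_connectedSpace.2 inferInstance

end Collapse

section FundamentalGroup

variable {X Y : Type*} [TopologicalSpace X] [TopologicalSpace Y]

theorem Path.Homotopic.Quotient.isQuotientMap_mk {x y : X} :
    IsQuotientMap (Path.Homotopic.Quotient.mk : Path x y → Path.Homotopic.Quotient x y) :=
  isQuotientMap_quotient_mk'

theorem Path.Homotopic.Quotient.continuous_map {x y : X} (p : C(X, Y)) :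
    Continuous fun γ : Path.Homotopic.Quotient x y => γ.map p := by
  refine isQuotientMap_mk.continuous_iff.2 (isQuotientMap_mk.continuous.comp
    (f := fun γ : Path x y => γ.map p.continuous) ?_)
  exact continuous_induced_rng.2 ((ContinuousMap.continuous_postcomp p).comp continuous_induced_dom)

theorem StarCondition.denseRange_map {n : ℕ} {A : Fin n → Set X} (hstar : StarCondition A)
    (x y : X) :
    DenseRange fun γ : Path.Homotopic.Quotient x y => γ.map (collapseMap A) := by
  intro c
  obtain ⟨γ, rfl⟩ := Path.Homotopic.Quotient.mk_surjective c
  refine mem_closure_iff.2 fun O hO hγ => ?_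
  obtain ⟨n, W, hW, hWO⟩ := Path.exists_dyadic_of_mem_nhds
    ((hO.preimage Path.Homotopic.Quotient.isQuotientMap_mk.continuous).mem_nhds hγ)
  obtain ⟨f, δ, hfδ, hδ⟩ := exists_path_homotopic_of_dyadic collapseMap_surjective
    (fun V hV x x' γ hγ => hstar.liftRel hV x x' γ hγ) n x y γ W hW
  refine ⟨_, hWO δ hδ, Path.Homotopic.Quotient.mk f, ?_⟩
  exact Path.Homotopic.Quotient.eq.2 hfδ

/-- A path connected space is semi-locally simply connected as soon as one homotopy class of loops
is open in the topological fundamental group. -/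
theorem semiLocallySimplyConnected_of_isOpen_singleton [PathConnectedSpace Y] {y₀ : Y}
    {c : Path.Homotopic.Quotient y₀ y₀} (hc : IsOpen {c}) : SemiLocallySimplyConnected Y := by
  intro y
  obtain ⟨g, rfl⟩ := Path.Homotopic.Quotient.mk_surjective c
  let β : Path y₀ y := PathConnectedSpace.somePath y₀ y
  let g' : Path y₀ y := g.trans β
  let F : Path y y → Path y₀ y₀ := fun α => (g'.trans α).trans β.symm
  have hF : Continuous F := by fun_prop
  have hnull : ∀ α, (F α).Homotopic g ↔ α.Homotopic (Path.refl y) := by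
    intro α
    have cancel : ∀ {z w v : Y} (p : Path.Homotopic.Quotient z w)
        (q : Path.Homotopic.Quotient w v), p.symm.trans (p.trans q) = q := fun p q => by
      rw [← Path.Homotopic.Quotient.trans_assoc, Path.Homotopic.Quotient.symm_trans,
        Path.Homotopic.Quotient.refl_trans]
    simp only [← Path.Homotopic.Quotient.eq, F, g', Path.Homotopic.Quotient.mk_trans,
      Path.Homotopic.Quotient.mk_symm, Path.Homotopic.Quotient.mk_refl]
    generalize Path.Homotopic.Quotient.mk α = α
    generalize Path.Homotopic.Quotient.mk g = g
    generalize Path.Homotopic.Quotient.mk β = β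
    constructor
    · intro h
      have h' := congrArg (fun e => β.symm.trans (g.symm.trans (e.trans β))) h
      simpa [Path.Homotopic.Quotient.trans_assoc, cancel] using h'
    · rintro rfl
      simp [Path.Homotopic.Quotient.trans_assoc]
  have hopen : IsOpen {α : Path y y | α.Homotopic (Path.refl y)} := by
    convert (hc.preimage Path.Homotopic.Quotient.isQuotientMap_mk.continuous).preimage hF using 1
    ext α
    exact (hnull α).symm.trans Path.Homotopic.Quotient.eq.symm
  obtain ⟨U, hU, hyU, h⟩ :=
    Path.exists_isOpen_forall_mem_of_mem_nhds_refl (hopen.mem_nhds (Path.Homotopic.refl _))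
  exact ⟨U, hU, hyU, fun γ => h _ fun t => (γ t).2⟩

end FundamentalGroup

/-- If `(X, A₁, …, Aₙ)` satisfies condition (*) and `π₁ᵗᵒᵖ(X,a)` is a compact, countable
quasitopological group, then either `X/(A₁,…,Aₙ)` is semi-locally simply connected or
`π₁ᵗᵒᵖ(X/(A₁,…,Aₙ),*)` is not Hausdorff. -/
theorem slsc_or_not_t2_of_compact_countable
    {X : Type*} [TopologicalSpace X]
    {n : ℕ} (A : Fin n → Set X) (hstar : StarCondition A)
    (a : X) (ha : a ∈ ⋃ i, A i)
    (hcomp : CompactSpace (Path.Homotopic.Quotient a a))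
    (hcount : Countable (Path.Homotopic.Quotient a a)) :
    SemiLocallySimplyConnected (Quot (collapseRelFam A)) ∨
      ¬ T2Space (Path.Homotopic.Quotient (Quot.mk (collapseRelFam A) a)
        (Quot.mk (collapseRelFam A) a)) := by
  refine or_iff_not_imp_right.2 fun hT2 => ?_
  rw [not_not] at hT2
  let G := Path.Homotopic.Quotient (Quot.mk (collapseRelFam A) a) (Quot.mk (collapseRelFam A) a)
  let φ : Path.Homotopic.Quotient a a → G := fun γ => γ.map (collapseMap A)
  have hφ : Continuous φ := Path.Homotopic.Quotient.continuous_map (collapseMap A)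
  have hsurj : Function.Surjective φ := by
    rw [← range_eq_univ, ← (isCompact_range hφ).isClosed.closure_eq]
    exact (hstar.denseRange_map a a).closure_range
  have : CompactSpace G := hsurj.compactSpace hφ
  have : Countable G := hsurj.countable
  have : Nonempty G := ⟨φ (Path.Homotopic.Quotient.refl a)⟩
  obtain ⟨c, hc⟩ := nonempty_interior_of_iUnion_of_closed (f := fun c : G => {c})
    (fun c => isClosed_singleton) (iUnion_of_singleton G)
  have hopen : IsOpen {c} := by
    rw [← interior_eq_iff_isOpen]
    exact (subset_singleton_iff_eq.1 interior_subset).resolve_left hc.ne_empty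
  have := hstar.pathConnectedSpace
  have : PathConnectedSpace (Quot (collapseRelFam A)) :=
    collapseMap_surjective.pathConnectedSpace (collapseMap A).continuous
  exact semiLocallySimplyConnected_of_isOpen_singleton hopen
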